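/- A subset U of (F_B(ℝ^m)^p, d_p) is relatively compact if and only if (i) U is uniformly p-mean bounded, i.e., bounded in d_p, and (ii) U is p-mean equi-left-continuous: for every ε > 0 there is δ > 0 such that (∫_h^1 H([u]_α, [u]_{α−h})^p dα)^{1/p} < ε for all 0 ≤ h < δ and all u ∈ U. -/

import Mathlib

open Metric Set MeasureTheory Filter

noncomputable section

/-- `Em m` is the Euclidean space ℝ^m. -/
abbrev Em (m : ℕ) := EuclideanSpace ℝ (Fin m)

/-- A set is star-shaped if it contains a point `x` such that the segment from `x`
to any point of the set lies in the set. -/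
def StarShaped {m : ℕ} (K : Set (Em m)) : Prop :=
  ∃ x ∈ K, ∀ y ∈ K, segment ℝ x y ⊆ K

/-- The kernel of a set: all points seeing the whole set. -/
def kern {m : ℕ} (K : Set (Em m)) : Set (Em m) :=
  {x | x ∈ K ∧ ∀ y ∈ K, segment ℝ x y ⊆ K}

/-- Kuratowski upper limit of a sequence of sets. -/
def KLimsup {m : ℕ} (C : ℕ → Set (Em m)) : Set (Em m) :=
  ⋂ n : ℕ, closure (⋃ k : ℕ, ⋃ _ : n ≤ k, C k)

/-- Kuratowski lower limit of a sequence of sets. -/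
def KLiminf {m : ℕ} (C : ℕ → Set (Em m)) : Set (Em m) :=
  {x | ∃ f : ℕ → Em m, (∀ n, f n ∈ C n) ∧ Tendsto f atTop (nhds x)}

/-- The α-cut of a fuzzy set `u`, for α > 0. -/
def acut {m : ℕ} (u : Em m → ℝ) (a : ℝ) : Set (Em m) := {x | a ≤ u x}

/-- The support (0-cut) of a fuzzy set. -/
def fsupp {m : ℕ} (u : Em m → ℝ) : Set (Em m) := closure {x | 0 < u x}

/-- Membership in `F_B(ℝ^m)^p`: normal, upper semi-continuous fuzzy sets with
compact α-cuts for α ∈ (0,1] and α ↦ H([u]_α, {0})^p integrable on (0,1]. -/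
structure IsFuzzyBp {m : ℕ} (p : ℝ) (u : Em m → ℝ) : Prop where
  mem01 : ∀ x, u x ∈ Icc (0:ℝ) 1
  normal : ∃ x, u x = 1
  usc : UpperSemicontinuous u
  compactCuts : ∀ a ∈ Ioc (0:ℝ) 1, IsCompact (acut u a)
  lp : IntegrableOn (fun a => hausdorffDist (acut u a) ({0} : Set (Em m)) ^ p)
        (Ioc (0:ℝ) 1)

/-- Membership in `F_B(ℝ^m)`: normal, upper semi-continuous fuzzy sets with
bounded (hence compact closed) support. -/
structure IsFuzzyB {m : ℕ} (u : Em m → ℝ) : Prop where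
  mem01 : ∀ x, u x ∈ Icc (0:ℝ) 1
  normal : ∃ x, u x = 1
  usc : UpperSemicontinuous u
  bddSupp : Bornology.IsBounded {x | 0 < u x}

/-- The `d_p` metric on fuzzy sets. -/
def dp {m : ℕ} (p : ℝ) (u v : Em m → ℝ) : ℝ :=
  (∫ a in Ioc (0:ℝ) 1, hausdorffDist (acut u a) (acut v a) ^ p) ^ (1/p)

/-- `d_p` distance to the crisp origin `0̂`. -/
def dpOrigin {m : ℕ} (p : ℝ) (u : Em m → ℝ) : ℝ :=
  (∫ a in Ioc (0:ℝ) 1, hausdorffDist (acut u a) ({0} : Set (Em m)) ^ p) ^ (1/p)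

/-- Uniformly p-mean bounded family. -/
def UPMB {m : ℕ} (p : ℝ) (U : Set (Em m → ℝ)) : Prop :=
  ∃ M : ℝ, ∀ u ∈ U, dpOrigin p u ≤ M

/-- p-mean equi-left-continuous family. -/
def PMELC {m : ℕ} (p : ℝ) (U : Set (Em m → ℝ)) : Prop :=
  ∀ ε > (0:ℝ), ∃ δ > (0:ℝ), ∀ h : ℝ, 0 ≤ h → h < δ → ∀ u ∈ U,
    (∫ a in Ioc h 1, hausdorffDist (acut u a) (acut u (a - h)) ^ p) ^ (1/p) < ε

/-- Truncation `u^{(a)}` of a fuzzy set at level `a`. -/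
def ftrunc {m : ℕ} (u : Em m → ℝ) (a : ℝ) : Em m → ℝ :=
  fun x => if a ≤ u x then u x else 0

/-- The kernel of a fuzzy set: intersection of the kernels of its cuts. -/
def fker {m : ℕ} (u : Em m → ℝ) : Set (Em m) :=
  ⋂ a ∈ Ioc (0:ℝ) 1, kern (acut u a)

/-- The full cut-family of a fuzzy set, with the 0-cut being the support. -/
def cutF {m : ℕ} (u : Em m → ℝ) (a : ℝ) : Set (Em m) :=
  if a = 0 then fsupp u else acut u a

/-- Conditions (i)–(iv) of the representation theorem for `F_B(ℝ^m)^p`. -/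
def GoodFamily {m : ℕ} (p : ℝ) (v : ℝ → Set (Em m)) : Prop :=
  (∀ l ∈ Ioc (0:ℝ) 1, (v l).Nonempty ∧ IsCompact (v l)) ∧
  (∀ l ∈ Ioc (0:ℝ) 1, v l = ⋂ g ∈ Ico (0:ℝ) l, v g) ∧
  (v 0 = closure (⋃ g ∈ Ioc (0:ℝ) 1, v g)) ∧
  IntegrableOn (fun a => hausdorffDist (v a) ({0} : Set (Em m)) ^ p) (Ioc (0:ℝ) 1)


open scoped ENNReal Topology

section Aux
variable {m : ℕ}

structure Good (u : Em m → ℝ) : Prop where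
  mem01 : ∀ x, u x ∈ Icc (0:ℝ) 1
  normal : ∃ x, u x = 1
  usc : UpperSemicontinuous u
  compactCuts : ∀ a ∈ Ioc (0:ℝ) 1, IsCompact (acut u a)

theorem IsFuzzyBp.good {p : ℝ} {u : Em m → ℝ} (h : IsFuzzyBp p u) : Good u :=
  ⟨h.mem01, h.normal, h.usc, h.compactCuts⟩

theorem acut_anti (u : Em m → ℝ) {a b : ℝ} (h : a ≤ b) : acut u b ⊆ acut u a :=
  fun _ hx => h.trans hx

theorem Good.ne {u : Em m → ℝ} (h : Good u) {a : ℝ} (ha : a ≤ 1) : (acut u a).Nonempty := by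
  obtain ⟨x, hx⟩ := h.normal
  exact ⟨x, by simp [acut, hx, ha]⟩

theorem Good.bdd {u : Em m → ℝ} (h : Good u) {a : ℝ} (ha : a ∈ Ioc (0:ℝ) 1) :
    Bornology.IsBounded (acut u a) := (h.compactCuts a ha).isBounded

/-- the dense sequence -/
def dsq (m : ℕ) : ℕ → Em m := TopologicalSpace.denseSeq (Em m)

theorem abs_infDist_le {K L : Set (Em m)} (hK : K.Nonempty) (hL : L.Nonempty)
    (bK : Bornology.IsBounded K) (bL : Bornology.IsBounded L) (x : Em m) :
    |infDist x K - infDist x L| ≤ hausdorffDist K L := by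
  have fin := hausdorffEDist_ne_top_of_nonempty_of_bounded hK hL bK bL
  have fin' := hausdorffEDist_ne_top_of_nonempty_of_bounded hL hK bL bK
  have h1 := infDist_le_infDist_add_hausdorffDist (x := x) fin
  have h2 := infDist_le_infDist_add_hausdorffDist (x := x) fin'
  rw [hausdorffDist_comm] at h2
  rw [abs_le]; constructor <;> linarith

theorem hd_le_of_dsq {K L : Set (Em m)} {r : ℝ} (hr : 0 ≤ r)
    (h : ∀ i, |infDist (dsq m i) K - infDist (dsq m i) L| ≤ r) : hausdorffDist K L ≤ r := by
  have key : ∀ x, |infDist x K - infDist x L| ≤ r := by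
    intro x
    have hc : IsClosed {x : Em m | |infDist x K - infDist x L| ≤ r} :=
      isClosed_le (((continuous_infDist_pt K).sub (continuous_infDist_pt L)).abs) continuous_const
    have hd : Dense (Set.range (dsq m)) := TopologicalSpace.denseRange_denseSeq (Em m)
    have : Set.range (dsq m) ⊆ {x : Em m | |infDist x K - infDist x L| ≤ r} := by
      rintro _ ⟨i, rfl⟩; exact h i
    exact hc.closure_subset_iff.2 this (hd x)
  apply hausdorffDist_le_of_infDist hr
  · intro x hx
    have := key x
    rw [infDist_zero_of_mem hx] at this
    have := (abs_le.1 this).1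
    linarith
  · intro x hx
    have := key x
    rw [infDist_zero_of_mem hx] at this
    have := (abs_le.1 this).2
    linarith

theorem hd_tendsto {K : ℕ → Set (Em m)} {L : Set (Em m)} {R : ℝ}
    (hKR : ∀ᶠ n in atTop, K n ⊆ closedBall 0 R) (hLR : L ⊆ closedBall 0 R)
    (h : ∀ i, Tendsto (fun n => infDist (dsq m i) (K n)) atTop (𝓝 (infDist (dsq m i) L))) :
    Tendsto (fun n => hausdorffDist (K n) L) atTop (𝓝 0) := by
  rw [Metric.tendsto_nhds]
  intro ε hε
  have hc : IsCompact (closedBall (0 : Em m) R) := isCompact_closedBall _ _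
  obtain ⟨t, ht⟩ := hc.elim_finite_subcover (fun i : ℕ => ball (dsq m i) (ε/4))
    (fun i => isOpen_ball) (by
      intro x _
      have hd : Dense (Set.range (dsq m)) := TopologicalSpace.denseRange_denseSeq (Em m)
      obtain ⟨y, hy, ⟨i, rfl⟩⟩ := Metric.dense_iff.1 hd x (ε/4) (by positivity)
      · exact mem_iUnion.2 ⟨i, by rw [mem_ball, dist_comm]; exact hy⟩)
  have hev : ∀ᶠ n in atTop, ∀ i ∈ t, |infDist (dsq m i) (K n) - infDist (dsq m i) L| < ε/4 := by
    rw [Filter.eventually_all_finset]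
    intro i _
    have := (Metric.tendsto_nhds.1 (h i)) (ε/4) (by positivity)
    simpa [Real.dist_eq] using this
  filter_upwards [hev, hKR] with n hn hK
  have key : ∀ x ∈ closedBall (0 : Em m) R, |infDist x (K n) - infDist x L| ≤ 3*ε/4 := by
    intro x hx
    obtain ⟨i, hi, hxi⟩ := mem_iUnion₂.1 (ht hx)
    rw [mem_ball] at hxi
    have h1 := hn i hi
    have a1 := infDist_le_infDist_add_dist (x := x) (y := dsq m i) (s := K n)
    have a2 := infDist_le_infDist_add_dist (x := dsq m i) (y := x) (s := K n)
    have a3 := infDist_le_infDist_add_dist (x := x) (y := dsq m i) (s := L)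
    have a4 := infDist_le_infDist_add_dist (x := dsq m i) (y := x) (s := L)
    rw [dist_comm] at a2 a4
    rw [abs_lt] at h1
    rw [abs_le]; constructor <;> linarith [h1.1, h1.2]
  have : hausdorffDist (K n) L ≤ 3*ε/4 := by
    apply hausdorffDist_le_of_infDist (by positivity)
    · intro x hx
      have := key x (hK hx)
      rw [infDist_zero_of_mem hx] at this
      have := (abs_le.1 this).1
      linarith
    · intro x hx
      have := key x (hLR hx)
      rw [infDist_zero_of_mem hx] at this
      have := (abs_le.1 this).2
      linarith
  rw [Real.dist_eq, sub_zero, abs_of_nonneg hausdorffDist_nonneg]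
  linarith

theorem hd_aemeas {A B : ℝ → Set (Em m)} {S : Set ℝ} (hS : MeasurableSet S)
    (hA : AntitoneOn A S) (hB : AntitoneOn B S)
    (nA : ∀ a ∈ S, (A a).Nonempty) (nB : ∀ a ∈ S, (B a).Nonempty)
    (bA : ∀ a ∈ S, Bornology.IsBounded (A a)) (bB : ∀ a ∈ S, Bornology.IsBounded (B a)) :
    AEMeasurable (fun a => hausdorffDist (A a) (B a)) (volume.restrict S) := by
  have mono : ∀ {C : ℝ → Set (Em m)}, AntitoneOn C S → (∀ a ∈ S, (C a).Nonempty) →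
      ∀ x, AEMeasurable (fun a => infDist x (C a)) (volume.restrict S) := by
    intro C hC nC x
    apply aemeasurable_restrict_of_monotoneOn hS
    intro a ha b hb hab
    exact infDist_le_infDist_of_subset (hC ha hb hab) (nC b hb)
  have h1 : AEMeasurable (fun a => ⨆ i, ENNReal.ofReal
      |infDist (dsq m i) (A a) - infDist (dsq m i) (B a)|) (volume.restrict S) := by
    apply AEMeasurable.iSup
    intro i
    exact (((mono hA nA _).sub (mono hB nB _)).norm).ennreal_ofReal
  refine h1.ennreal_toReal.congr ?_
  filter_upwards [ae_restrict_mem hS] with a ha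
  set s := ⨆ i, ENNReal.ofReal |infDist (dsq m i) (A a) - infDist (dsq m i) (B a)|
  have hle : s ≤ ENNReal.ofReal (hausdorffDist (A a) (B a)) := iSup_le fun i =>
    ENNReal.ofReal_le_ofReal (abs_infDist_le (nA a ha) (nB a ha) (bA a ha) (bB a ha) _)
  have htop : s ≠ ⊤ := (hle.trans_lt ENNReal.ofReal_lt_top).ne
  apply le_antisymm
  · exact ENNReal.toReal_le_of_le_ofReal hausdorffDist_nonneg hle
  · apply hd_le_of_dsq ENNReal.toReal_nonneg
    intro i
    rw [← ENNReal.ofReal_le_iff_le_toReal htop]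
    exact le_iSup (fun i => ENNReal.ofReal |infDist (dsq m i) (A a) - infDist (dsq m i) (B a)|) i

theorem hd_tri {K L N : Set (Em m)} (hK : K.Nonempty) (hL : L.Nonempty)
    (bK : Bornology.IsBounded K) (bL : Bornology.IsBounded L) :
    hausdorffDist K N ≤ hausdorffDist K L + hausdorffDist L N :=
  hausdorffDist_triangle (hausdorffEDist_ne_top_of_nonempty_of_bounded hK hL bK bL)

/-- radius function -/
def rad (u : Em m → ℝ) (a : ℝ) : ℝ := hausdorffDist (acut u a) ({0} : Set (Em m))

theorem Good.subset_ball {u : Em m → ℝ} (h : Good u) {a : ℝ} (ha : a ∈ Ioc (0:ℝ) 1) :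
    acut u a ⊆ closedBall 0 (rad u a) := by
  intro x hx
  have := infDist_le_hausdorffDist_of_mem hx (hausdorffEDist_ne_top_of_nonempty_of_bounded
    (h.ne ha.2) (singleton_nonempty (0 : Em m)) (h.bdd ha) Bornology.isBounded_singleton)
  rw [infDist_singleton] at this
  exact this

theorem rad_le {u : Em m → ℝ} {a R : ℝ} (hn : (acut u a).Nonempty)
    (h : acut u a ⊆ closedBall 0 R) : rad u a ≤ R := by
  obtain ⟨x, hx⟩ := hn
  have hx' := h hx
  rw [mem_closedBall] at hx'
  apply hausdorffDist_le_of_mem_dist (dist_nonneg.trans hx')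
  · intro y hy; exact ⟨0, rfl, h hy⟩
  · rintro y rfl; exact ⟨x, hx, by rwa [dist_comm]⟩

theorem rad_nonneg (u : Em m → ℝ) (a : ℝ) : 0 ≤ rad u a := hausdorffDist_nonneg

theorem Good.rad_anti {u : Em m → ℝ} (h : Good u) {a b : ℝ} (ha : 0 < a) (hab : a ≤ b)
    (hb : b ≤ 1) : rad u b ≤ rad u a :=
  rad_le (h.ne hb) ((acut_anti u hab).trans (h.subset_ball ⟨ha, hab.trans hb⟩))

theorem Good.hd_le {u v : Em m → ℝ} (hu : Good u) {a b : ℝ}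
    (ha : a ∈ Ioc (0:ℝ) 1) :
    hausdorffDist (acut u a) (acut v b) ≤ rad u a + rad v b := by
  have := hd_tri (N := acut v b) (hu.ne ha.2) (singleton_nonempty (0 : Em m)) (hu.bdd ha)
    Bornology.isBounded_singleton
  rwa [hausdorffDist_comm (s := {0})] at this

theorem Good.left_cont {u : Em m → ℝ} (h : Good u) {a : ℝ} (ha : a ∈ Ioc (0:ℝ) 1)
    (x : Em m) {c : ℝ} (hc : c < infDist x (acut u a)) :
    ∃ b, 0 < b ∧ b < a ∧ c < infDist x (acut u b) := by
  obtain ⟨ha0, ha1⟩ := ha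
  have hcomp : IsCompact (acut u (a/2) ∩ closedBall x c) :=
    (h.compactCuts _ ⟨by linarith, by linarith⟩).inter_right isClosed_closedBall
  rcases (acut u (a/2) ∩ closedBall x c).eq_empty_or_nonempty with he | hne
  · refine ⟨a/2, by linarith, by linarith, ?_⟩
    obtain ⟨y, hy, hxy⟩ := (h.compactCuts (a/2) ⟨by linarith, by linarith⟩).exists_infDist_eq_dist
      (h.ne (by linarith)) x
    rw [hxy]
    by_contra hcon
    have : y ∈ acut u (a/2) ∩ closedBall x c := ⟨hy, by rw [mem_closedBall, dist_comm]; linarith⟩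
    rw [he] at this; exact this
  · obtain ⟨z, hz, hzmax⟩ := UpperSemicontinuousOn.exists_isMaxOn hne hcomp
      (h.usc.upperSemicontinuousOn _)
    have hza : u z < a := by
      by_contra hcon
      have := infDist_le_dist_of_mem (x := x) (show z ∈ acut u a from not_lt.1 hcon)
      have h2 := hz.2
      rw [mem_closedBall, dist_comm] at h2
      linarith
    have hz2 : a/2 ≤ u z := hz.1
    refine ⟨(u z + a)/2, by linarith, by linarith, ?_⟩
    obtain ⟨y, hy, hxy⟩ := (h.compactCuts ((u z + a)/2)
      ⟨by linarith, by linarith⟩).exists_infDist_eq_dist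
      (h.ne (by linarith)) x
    rw [hxy]
    by_contra hcon
    have hy' : (u z + a)/2 ≤ u y := hy
    have : y ∈ acut u (a/2) ∩ closedBall x c :=
      ⟨show a/2 ≤ u y by linarith, by rw [mem_closedBall, dist_comm]; linarith⟩
    have := hzmax this
    simp only [mem_ofPred_eq] at this
    linarith

theorem small_scale {C ε : ℝ≥0∞} (hC : C ≠ ⊤) (hε : 0 < ε) :
    ∃ δ : ℝ, 0 < δ ∧ C * (ENNReal.ofReal δ + ENNReal.ofReal δ + ENNReal.ofReal δ) ≤ ε := by
  have h : Tendsto (fun δ : ℝ => C * (ENNReal.ofReal δ + ENNReal.ofReal δ + ENNReal.ofReal δ))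
      (𝓝[>] 0) (𝓝 (C * (ENNReal.ofReal 0 + ENNReal.ofReal 0 + ENNReal.ofReal 0))) := by
    have h0 : Tendsto (fun δ : ℝ => ENNReal.ofReal δ) (𝓝[>] 0) (𝓝 (ENNReal.ofReal 0)) :=
      (ENNReal.continuous_ofReal.tendsto 0).mono_left nhdsWithin_le_nhds
    exact ENNReal.Tendsto.const_mul ((h0.add h0).add h0) (Or.inr hC)
  simp only [ENNReal.ofReal_zero, add_zero, mul_zero] at h
  have h1 := h.eventually (gt_mem_nhds hε)
  have h2 : ∀ᶠ δ : ℝ in 𝓝[>] 0, 0 < δ := self_mem_nhdsWithin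
  obtain ⟨δ, hδ, hδ0⟩ := (h1.and h2).exists
  exact ⟨δ, hδ0, hδ.le⟩

theorem rpow3 {p x a b c : ℝ} (hp : 0 < p) (hx : 0 ≤ x) (ha : 0 ≤ a) (hb : 0 ≤ b) (hc : 0 ≤ c)
    (h : x ≤ a + b + c) : ENNReal.ofReal (x ^ p) ≤ ENNReal.ofReal (3 ^ p) *
      (ENNReal.ofReal (a ^ p) + ENNReal.ofReal (b ^ p) + ENNReal.ofReal (c ^ p)) := by
  have ha' := Real.rpow_nonneg ha p
  have hb' := Real.rpow_nonneg hb p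
  have hc' := Real.rpow_nonneg hc p
  rw [← ENNReal.ofReal_add ha' hb', ← ENNReal.ofReal_add (by positivity) hc',
    ← ENNReal.ofReal_mul (by positivity)]
  apply ENNReal.ofReal_le_ofReal
  have key : ∀ y, 0 ≤ y → x ≤ 3 * y → x ^ p ≤ 3 ^ p * y ^ p := fun y hy hxy => by
    rw [← Real.mul_rpow (by norm_num) hy]
    exact Real.rpow_le_rpow hx hxy hp.le
  have h3 : (0:ℝ) ≤ 3 ^ p := by positivity
  rcases le_total a b with h1 | h1 <;> rcases le_total b c with h2 | h2 <;>
    rcases le_total a c with h4 | h4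
  all_goals first
    | (refine (key a ha (by linarith)).trans ?_; gcongr; linarith)
    | (refine (key b hb (by linarith)).trans ?_; gcongr; linarith)
    | (refine (key c hc (by linarith)).trans ?_; gcongr; linarith)

theorem rpow2 {p x a b : ℝ} (hp : 0 < p) (hx : 0 ≤ x) (ha : 0 ≤ a) (hb : 0 ≤ b)
    (h : x ≤ a + b) : ENNReal.ofReal (x ^ p) ≤ ENNReal.ofReal (3 ^ p) *
      (ENNReal.ofReal (a ^ p) + ENNReal.ofReal (b ^ p)) := by
  have := rpow3 (c := 0) hp hx ha hb le_rfl (by linarith)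
  simpa [Real.zero_rpow hp.ne'] using this

theorem core {G : ℕ → ℝ → ℝ≥0∞}
    (hm : ∀ n, AEMeasurable (G n) (volume.restrict (Ioc (0:ℝ) 1)))
    (hlim : ∀ᵐ a ∂(volume.restrict (Ioc (0:ℝ) 1)), Tendsto (fun n => G n a) atTop (𝓝 0))
    (hb : ∀ η : ℝ, 0 < η → ∃ C : ℝ≥0∞, C ≠ ⊤ ∧ ∀ᶠ n in atTop, ∀ a ∈ Ioc η 1, G n a ≤ C)
    (ht : ∀ ε : ℝ≥0∞, 0 < ε → ∃ η : ℝ, 0 < η ∧ η ≤ 1 ∧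
      ∀ᶠ n in atTop, ∫⁻ a in Ioc 0 η, G n a ≤ ε) :
    Tendsto (fun n => ∫⁻ a in Ioc (0:ℝ) 1, G n a) atTop (𝓝 0) := by
  rw [ENNReal.tendsto_nhds_zero]
  intro ε hε
  obtain ⟨η, hη, hη1, hev⟩ := ht (ε/2) (ENNReal.half_pos hε.ne')
  obtain ⟨C, hC, hCev⟩ := hb η hη
  have hsub : Ioc η 1 ⊆ Ioc (0:ℝ) 1 := Ioc_subset_Ioc_left hη.le
  have hle : volume.restrict (Ioc η 1) ≤ volume.restrict (Ioc (0:ℝ) 1) :=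
    Measure.restrict_mono hsub le_rfl
  have hD : Tendsto (fun n => ∫⁻ a in Ioc η 1, min (G n a) C) atTop
      (𝓝 (∫⁻ a in Ioc η 1, 0)) := by
    refine tendsto_lintegral_of_dominated_convergence' (fun _ => C) ?_ ?_ ?_ ?_
    · intro n; exact ((hm n).mono_measure hle).min aemeasurable_const
    · intro n; exact ae_of_all _ fun a => min_le_right _ _
    · rw [setLIntegral_const]; exact ENNReal.mul_ne_top hC (by simp)
    · filter_upwards [hlim.filter_mono (ae_mono hle)] with a ha
      refine tendsto_of_tendsto_of_tendsto_of_le_of_le tendsto_const_nhds ha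
        (fun _ => zero_le) (fun _ => min_le_left _ _)
  rw [lintegral_zero] at hD
  have hD' := (ENNReal.tendsto_nhds_zero.1 hD) (ε/2) (ENNReal.half_pos hε.ne')
  filter_upwards [hev, hCev, hD'] with n h1 h2 h3
  have : Ioc (0:ℝ) 1 = Ioc 0 η ∪ Ioc η 1 := (Ioc_union_Ioc_eq_Ioc hη.le hη1).symm
  rw [this]
  refine (lintegral_union_le _ _ _).trans ?_
  rw [← ENNReal.add_halves ε]
  refine add_le_add h1 (le_trans (le_of_eq ?_) h3)
  apply setLIntegral_congr_fun measurableSet_Ioc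
  intro a ha
  exact (min_eq_left (h2 a ha)).symm

theorem lint_shift (F : ℝ → ℝ≥0∞) (h s t : ℝ) :
    ∫⁻ a in Ioc (h + s) (h + t), F (a - h) = ∫⁻ a in Ioc s t, F a := by
  rw [← lintegral_indicator measurableSet_Ioc, ← lintegral_indicator measurableSet_Ioc,
    ← lintegral_sub_right_eq_self ((Ioc s t).indicator F) h]
  congr 1
  ext a
  simp only [indicator, mem_Ioc]
  have : (h + s < a ∧ a ≤ h + t) ↔ (s < a - h ∧ a - h ≤ t) := by
    constructor <;> rintro ⟨h1, h2⟩ <;> constructor <;> linarith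
  simp only [this]

variable {p : ℝ}

theorem meas_uv {u v : Em m → ℝ} (hu : Good u) (hv : Good v) :
    AEMeasurable (fun a => hausdorffDist (acut u a) (acut v a)) (volume.restrict (Ioc 0 1)) :=
  hd_aemeas measurableSet_Ioc (fun _ _ _ _ h => acut_anti u h) (fun _ _ _ _ h => acut_anti v h)
    (fun _ ha => hu.ne ha.2) (fun _ ha => hv.ne ha.2) (fun _ ha => hu.bdd ha) (fun _ ha => hv.bdd ha)

theorem meas_rad {u : Em m → ℝ} (hu : Good u) :
    AEMeasurable (rad u) (volume.restrict (Ioc 0 1)) :=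
  hd_aemeas (B := fun _ => {0}) measurableSet_Ioc (fun _ _ _ _ h => acut_anti u h)
    (fun _ _ _ _ _ => le_rfl)
    (fun _ ha => hu.ne ha.2) (fun _ _ => singleton_nonempty _) (fun _ ha => hu.bdd ha)
    (fun _ _ => Bornology.isBounded_singleton)

theorem meas_shift {u : Em m → ℝ} (hu : Good u) {h : ℝ} (hh : 0 ≤ h) :
    AEMeasurable (fun a => hausdorffDist (acut u a) (acut u (a - h)))
      (volume.restrict (Ioc h 1)) := by
  have h1 : ∀ a ∈ Ioc h 1, a ∈ Ioc (0:ℝ) 1 := fun a ha => ⟨hh.trans_lt ha.1, ha.2⟩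
  have h2 : ∀ a ∈ Ioc h 1, a - h ∈ Ioc (0:ℝ) 1 := fun a ha =>
    ⟨by linarith [ha.1], by linarith [ha.2]⟩
  exact hd_aemeas (B := fun a => acut u (a - h)) measurableSet_Ioc (fun _ _ _ _ h => acut_anti u h)
    (fun _ _ _ _ h => acut_anti u (by linarith))
    (fun a ha => hu.ne ha.2) (fun a ha => hu.ne (h2 a ha).2) (fun a ha => hu.bdd (h1 a ha))
    (fun a ha => hu.bdd (h2 a ha))

/-- lower integrals of p-th powers -/
def JJ (p : ℝ) (u v : Em m → ℝ) : ℝ≥0∞ :=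
  ∫⁻ a in Ioc (0:ℝ) 1, ENNReal.ofReal (hausdorffDist (acut u a) (acut v a) ^ p)

def JR (p : ℝ) (u : Em m → ℝ) (η : ℝ) : ℝ≥0∞ :=
  ∫⁻ a in Ioc (0:ℝ) η, ENNReal.ofReal (rad u a ^ p)

def JS (p : ℝ) (u : Em m → ℝ) (h : ℝ) : ℝ≥0∞ :=
  ∫⁻ a in Ioc h 1, ENNReal.ofReal (hausdorffDist (acut u a) (acut u (a - h)) ^ p)

theorem int_eq {F : ℝ → ℝ} {S : Set ℝ} (hF : AEMeasurable F (volume.restrict S))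
    (h0 : ∀ a, 0 ≤ F a) :
    ∫ a in S, F a ^ p = (∫⁻ a in S, ENNReal.ofReal (F a ^ p)).toReal :=
  integral_eq_lintegral_of_nonneg_ae (ae_of_all _ fun a => Real.rpow_nonneg (h0 a) p)
    (hF.pow_const p).aestronglyMeasurable

theorem JR_mono (u : Em m → ℝ) {s t : ℝ} (h : s ≤ t) : JR p u s ≤ JR p u t :=
  lintegral_mono_set (Ioc_subset_Ioc_right h)

theorem JR_fin {u : Em m → ℝ} (hu : IsFuzzyBp p u) : JR p u 1 < ⊤ := by
  have h := hu.lp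
  have := h.lintegral_lt_top
  exact this

theorem JR_lt {u : Em m → ℝ} (hu : Good u) {η : ℝ} (hη : η ≤ 1) (q : ℝ → ℝ≥0∞) :
    ∫⁻ a in Ioc (0:ℝ) η, (ENNReal.ofReal (rad u a ^ p) + q a) = JR p u η + ∫⁻ a in Ioc 0 η, q a := by
  rw [lintegral_add_left' (((meas_rad hu).mono_measure
    (Measure.restrict_mono (Ioc_subset_Ioc_right hη) le_rfl)).pow_const p).ennreal_ofReal]
  rfl

theorem Good.tail_le {u v : Em m → ℝ} (hp : 0 < p) (hu : Good u) {η : ℝ} (hη : η ≤ 1) :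
    ∫⁻ a in Ioc (0:ℝ) η, ENNReal.ofReal (hausdorffDist (acut u a) (acut v a) ^ p) ≤
      ENNReal.ofReal (3 ^ p) * (JR p u η + JR p v η) := by
  calc _ ≤ ∫⁻ a in Ioc (0:ℝ) η, ENNReal.ofReal (3 ^ p) *
        (ENNReal.ofReal (rad u a ^ p) + ENNReal.ofReal (rad v a ^ p)) := by
        apply setLIntegral_mono' measurableSet_Ioc
        intro a ha
        exact rpow2 hp hausdorffDist_nonneg (rad_nonneg _ _) (rad_nonneg _ _)
          (hu.hd_le ⟨ha.1, ha.2.trans hη⟩)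
    _ = _ := by
        rw [lintegral_const_mul' _ _ ENNReal.ofReal_ne_top, JR_lt hu hη]; rfl

theorem JJ_fin {u v : Em m → ℝ} (hp : 0 < p) (hu : IsFuzzyBp p u) (hv : IsFuzzyBp p v) :
    JJ p u v < ⊤ :=
  (hu.good.tail_le hp le_rfl).trans_lt (ENNReal.mul_lt_top ENNReal.ofReal_lt_top
    (ENNReal.add_lt_top.2 ⟨JR_fin hu, JR_fin hv⟩))

/-- part of the shifted integral below level `η` -/
theorem Good.shift_tail {u : Em m → ℝ} (hp : 0 < p) (hu : Good u) {h η : ℝ} (hh : 0 ≤ h)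
    (hη : η ≤ 1) :
    ∫⁻ a in Ioc h η, ENNReal.ofReal (hausdorffDist (acut u a) (acut u (a - h)) ^ p) ≤
      ENNReal.ofReal (3 ^ p) * (JR p u η + JR p u η) := by
  calc _ ≤ ∫⁻ a in Ioc h η, ENNReal.ofReal (3 ^ p) *
        (ENNReal.ofReal (rad u a ^ p) + ENNReal.ofReal (rad u (a - h) ^ p)) := by
        apply setLIntegral_mono' measurableSet_Ioc
        intro a ha
        exact rpow2 hp hausdorffDist_nonneg (rad_nonneg _ _) (rad_nonneg _ _)
          (hu.hd_le ⟨hh.trans_lt ha.1, ha.2.trans hη⟩)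
    _ ≤ _ := by
        rw [lintegral_const_mul' _ _ ENNReal.ofReal_ne_top, lintegral_add_left'
          (((meas_rad hu).mono_measure
            (Measure.restrict_mono (Ioc_subset_Ioc hh hη) le_rfl)).pow_const p).ennreal_ofReal]
        gcongr
        · exact lintegral_mono_set (Ioc_subset_Ioc_left hh)
        · have := lint_shift (fun a => ENNReal.ofReal (rad u a ^ p)) h 0 (η - h)
          rw [add_zero, add_sub_cancel] at this
          rw [this]
          exact JR_mono u (by linarith)

theorem JS_fin {u : Em m → ℝ} (hp : 0 < p) (hu : IsFuzzyBp p u) {h : ℝ} (hh : 0 ≤ h) :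
    JS p u h < ⊤ :=
  (hu.good.shift_tail hp hh le_rfl).trans_lt (ENNReal.mul_lt_top ENNReal.ofReal_lt_top
    (ENNReal.add_lt_top.2 ⟨JR_fin hu, JR_fin hu⟩))

theorem dp_eq {u v : Em m → ℝ} (hu : Good u) (hv : Good v) :
    dp p u v = (JJ p u v).toReal ^ (1/p) := by
  rw [dp, int_eq (meas_uv hu hv) (fun _ => hausdorffDist_nonneg)]; rfl

theorem dpOrigin_eq {u : Em m → ℝ} (hu : Good u) :
    dpOrigin p u = (JR p u 1).toReal ^ (1/p) := by
  have := int_eq (p := p) (meas_rad hu) (rad_nonneg u)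
  unfold dpOrigin JR
  rw [← this]; rfl

theorem JS_eq {u : Em m → ℝ} (hu : Good u) {h : ℝ} (hh : 0 ≤ h) :
    (∫ a in Ioc h 1, hausdorffDist (acut u a) (acut u (a - h)) ^ p) ^ (1/p)
      = (JS p u h).toReal ^ (1/p) := by
  rw [int_eq (meas_shift hu hh) (fun _ => hausdorffDist_nonneg)]; rfl

theorem JR_tail {u : Em m → ℝ} (hu : IsFuzzyBp p u) {ε : ℝ≥0∞} (hε : 0 < ε) :
    ∃ η : ℝ, 0 < η ∧ η ≤ 1 ∧ JR p u η ≤ ε := by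
  obtain ⟨δ, hδ, h⟩ := exists_pos_setLIntegral_lt_of_measure_lt (JR_fin hu).ne hε.ne'
  have h0 : Tendsto (fun δ : ℝ => ENNReal.ofReal δ) (𝓝[>] 0) (𝓝 (ENNReal.ofReal 0)) :=
      (ENNReal.continuous_ofReal.tendsto 0).mono_left nhdsWithin_le_nhds
  rw [ENNReal.ofReal_zero] at h0
  have h1 := h0.eventually (gt_mem_nhds hδ)
  have h2 : ∀ᶠ δ : ℝ in 𝓝[>] 0, 0 < δ := self_mem_nhdsWithin
  have h3 : ∀ᶠ δ : ℝ in 𝓝[>] 0, δ < 1 := nhdsWithin_le_nhds (gt_mem_nhds one_pos)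
  obtain ⟨η, ⟨hηδ, hη0⟩, hη1⟩ := ((h1.and h2).and h3).exists
  refine ⟨η, hη0, hη1.le, ?_⟩
  have hs := h (Ioc 0 η) (lt_of_le_of_lt (Measure.restrict_apply_le _ _) (by simpa using hηδ))
  rw [Measure.restrict_restrict measurableSet_Ioc,
    inter_eq_left.2 (Ioc_subset_Ioc_right hη1.le)] at hs
  exact hs.le

theorem single_left {v : Em m → ℝ} (hp : 0 < p) (hv : IsFuzzyBp p v) {h : ℕ → ℝ}
    (hh : ∀ n, 0 ≤ h n) (hlim : Tendsto h atTop (𝓝 0)) :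
    Tendsto (fun n => JS p v (h n)) atTop (𝓝 0) := by
  have hg := hv.good
  have hsub : ∀ n, Ioc (h n) 1 ⊆ Ioc (0:ℝ) 1 := fun n => Ioc_subset_Ioc_left (hh n)
  have heq : ∀ n, JS p v (h n) = ∫⁻ a in Ioc (0:ℝ) 1, (Ioc (h n) 1).indicator
      (fun a => ENNReal.ofReal (hausdorffDist (acut v a) (acut v (a - h n)) ^ p)) a := by
    intro n
    rw [setLIntegral_indicator measurableSet_Ioc, inter_eq_left.2 (hsub n)]; rfl
  simp only [heq]
  apply core
  · intro n
    rw [aemeasurable_indicator_iff measurableSet_Ioc, Measure.restrict_restrict measurableSet_Ioc,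
      inter_eq_left.2 (hsub n)]
    exact ((meas_shift hg (hh n)).pow_const p).ennreal_ofReal
  · filter_upwards [ae_restrict_mem measurableSet_Ioc] with a ha
    have hev : ∀ᶠ n in atTop, h n < a/2 := hlim.eventually (gt_mem_nhds (half_pos ha.1))
    have hha : a / 2 ∈ Ioc (0:ℝ) 1 := ⟨half_pos ha.1, by linarith [ha.1, ha.2]⟩
    have ht : Tendsto (fun n => hausdorffDist (acut v (a - h n)) (acut v a)) atTop (𝓝 0) := by
      apply hd_tendsto (R := rad v (a/2))
      · filter_upwards [hev] with n hn
        exact (acut_anti v (by linarith)).trans (hg.subset_ball hha)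
      · exact (acut_anti v (by linarith [ha.1])).trans (hg.subset_ball hha)
      · intro i
        rw [tendsto_order]
        constructor
        · intro c hc
          obtain ⟨b, hb0, hba, hcb⟩ := hg.left_cont ha _ hc
          have : ∀ᶠ n in atTop, h n < a - b := hlim.eventually (gt_mem_nhds (by linarith))
          filter_upwards [this] with n hn
          exact hcb.trans_le (infDist_le_infDist_of_subset (acut_anti v (by linarith))
            (hg.ne (by linarith [hh n, ha.2])))
        · intro c hc
          refine Eventually.of_forall fun n => lt_of_le_of_lt ?_ hc
          exact infDist_le_infDist_of_subset (acut_anti v (by linarith [hh n])) (hg.ne ha.2)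
    have ht2 : Tendsto (fun n => ENNReal.ofReal
        (hausdorffDist (acut v a) (acut v (a - h n)) ^ p)) atTop (𝓝 0) := by
      have := ENNReal.tendsto_ofReal (ht.rpow_const (Or.inr hp.le) (p := p))
      simp only [Real.zero_rpow hp.ne', ENNReal.ofReal_zero] at this
      simpa only [hausdorffDist_comm] using this
    exact tendsto_of_tendsto_of_tendsto_of_le_of_le tendsto_const_nhds ht2
      (fun _ => zero_le) (fun n => indicator_le_self _ _ _)
  · intro η hη
    refine ⟨ENNReal.ofReal ((rad v (η/2) + rad v (η/2)) ^ p), ENNReal.ofReal_ne_top, ?_⟩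
    have hev : ∀ᶠ n in atTop, h n < η/2 := hlim.eventually (gt_mem_nhds (half_pos hη))
    filter_upwards [hev] with n hn a ha
    refine (indicator_le_self _ _ _).trans (ENNReal.ofReal_le_ofReal ?_)
    apply Real.rpow_le_rpow hausdorffDist_nonneg _ hp.le
    refine (hg.hd_le ⟨hη.trans ha.1, ha.2⟩).trans (add_le_add ?_ ?_)
    · exact hg.rad_anti (half_pos hη) (by linarith [ha.1]) ha.2
    · exact hg.rad_anti (half_pos hη) (by linarith [ha.1]) (by linarith [hh n, ha.2])
  · intro ε hε
    obtain ⟨δ, hδ, hδε⟩ := small_scale (C := ENNReal.ofReal (3 ^ p)) ENNReal.ofReal_ne_top hε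
    obtain ⟨η, hη0, hη1, hη⟩ := JR_tail hv (ENNReal.ofReal_pos.2 hδ)
    refine ⟨η, hη0, hη1, Eventually.of_forall fun n => ?_⟩
    rw [setLIntegral_indicator measurableSet_Ioc]
    have : Ioc (h n) 1 ∩ Ioc 0 η ⊆ Ioc (h n) η := fun a ha => ⟨ha.1.1, ha.2.2⟩
    refine (lintegral_mono_set this).trans ((hg.shift_tail hp (hh n) hη1).trans
      (le_trans ?_ hδε))
    exact mul_le_mul' le_rfl ((add_le_add hη hη).trans le_self_add)

theorem JJ_tendsto {f : ℕ → Em m → ℝ} {v : Em m → ℝ} (hp : 0 < p) (hf : ∀ n, IsFuzzyBp p (f n))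
    (hv : IsFuzzyBp p v) (h : Tendsto (fun n => dp p (f n) v) atTop (𝓝 0)) :
    Tendsto (fun n => JJ p (f n) v) atTop (𝓝 0) := by
  have h1 := h.rpow_const (Or.inr hp.le) (p := p)
  rw [Real.zero_rpow hp.ne'] at h1
  have h2 := ENNReal.tendsto_ofReal h1
  rw [ENNReal.ofReal_zero] at h2
  refine h2.congr fun n => ?_
  rw [dp_eq (hf n).good hv.good, ← Real.rpow_mul ENNReal.toReal_nonneg, one_div,
    inv_mul_cancel₀ hp.ne', Real.rpow_one, ENNReal.ofReal_toReal (JJ_fin hp (hf n) hv).ne]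

theorem JR_le {u v : Em m → ℝ} (hp : 0 < p) (hu : Good u) (hv : Good v) :
    JR p u 1 ≤ ENNReal.ofReal (3 ^ p) * (JJ p u v + JR p v 1) := by
  calc _ ≤ ∫⁻ a in Ioc (0:ℝ) 1, ENNReal.ofReal (3 ^ p) *
        (ENNReal.ofReal (hausdorffDist (acut u a) (acut v a) ^ p)
          + ENNReal.ofReal (rad v a ^ p)) := by
        apply setLIntegral_mono' measurableSet_Ioc
        intro a ha
        exact rpow2 hp (rad_nonneg _ _) hausdorffDist_nonneg (rad_nonneg _ _)
          (hd_tri (hu.ne ha.2) (hv.ne ha.2) (hu.bdd ha) (hv.bdd ha))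
    _ = _ := by
        rw [lintegral_const_mul' _ _ ENNReal.ofReal_ne_top, lintegral_add_left'
          ((meas_uv hu hv).pow_const p).ennreal_ofReal]
        rfl

theorem JS_le {u v : Em m → ℝ} (hp : 0 < p) (hu : Good u) (hv : Good v) {h : ℝ} (hh : 0 ≤ h) :
    JS p u h ≤ ENNReal.ofReal (3 ^ p) * (JJ p u v + JS p v h + JJ p u v) := by
  calc _ ≤ ∫⁻ a in Ioc h 1, ENNReal.ofReal (3 ^ p) *
        (ENNReal.ofReal (hausdorffDist (acut u a) (acut v a) ^ p)
          + ENNReal.ofReal (hausdorffDist (acut v a) (acut v (a - h)) ^ p)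
          + ENNReal.ofReal (hausdorffDist (acut u (a - h)) (acut v (a - h)) ^ p)) := by
        apply setLIntegral_mono' measurableSet_Ioc
        intro a ha
        have h1 : a ∈ Ioc (0:ℝ) 1 := ⟨hh.trans_lt ha.1, ha.2⟩
        have h2 : a - h ∈ Ioc (0:ℝ) 1 := ⟨by linarith [ha.1], by linarith [ha.2]⟩
        apply rpow3 hp hausdorffDist_nonneg hausdorffDist_nonneg hausdorffDist_nonneg
          hausdorffDist_nonneg
        have t1 := hd_tri (N := acut u (a - h)) (hu.ne h1.2) (hv.ne h1.2) (hu.bdd h1) (hv.bdd h1)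
        have t2 := hd_tri (N := acut u (a - h)) (hv.ne h1.2) (hv.ne h2.2) (hv.bdd h1) (hv.bdd h2)
        rw [hausdorffDist_comm (s := acut v (a - h)) (t := acut u (a - h))] at t2
        linarith
    _ ≤ _ := by
        rw [lintegral_const_mul' _ _ ENNReal.ofReal_ne_top, lintegral_add_left', lintegral_add_left']
        · gcongr
          · exact lintegral_mono_set (Ioc_subset_Ioc_left hh)
          · exact le_rfl
          · have := lint_shift (fun a => ENNReal.ofReal
              (hausdorffDist (acut u a) (acut v a) ^ p)) h 0 (1 - h)
            rw [add_zero, add_sub_cancel] at this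
            rw [this]
            exact lintegral_mono_set (Ioc_subset_Ioc_right (by linarith))
        · exact (((meas_uv hu hv).mono_measure
            (Measure.restrict_mono (Ioc_subset_Ioc_left hh) le_rfl)).pow_const p).ennreal_ofReal
        · exact (((meas_uv hu hv).mono_measure
            (Measure.restrict_mono (Ioc_subset_Ioc_left hh) le_rfl)).pow_const p).ennreal_ofReal.add
            ((meas_shift hv hh).pow_const p).ennreal_ofReal

theorem forward_bdd (hp : 0 < p) {U : Set (Em m → ℝ)} (hU : ∀ u ∈ U, IsFuzzyBp p u)
    (H : ∀ f : ℕ → (Em m → ℝ), (∀ n, f n ∈ U) →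
        ∃ (φ : ℕ → ℕ) (v : Em m → ℝ), StrictMono φ ∧ IsFuzzyBp p v ∧
          Tendsto (fun n => dp p (f (φ n)) v) atTop (𝓝 0)) : UPMB p U := by
  by_contra hcon
  simp only [UPMB, not_exists, not_forall, not_le] at hcon
  choose f hfU hf using fun n : ℕ => hcon n
  obtain ⟨φ, v, hφ, hv, hlim⟩ := H f hfU
  have hJ := JJ_tendsto hp (fun n => hU _ (hfU (φ n))) hv hlim
  have hev := hJ.eventually (gt_mem_nhds (zero_lt_one (α := ℝ≥0∞)))
  set B := ENNReal.ofReal (3 ^ p) * (1 + JR p v 1) with hB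
  have hBtop : B ≠ ⊤ := (ENNReal.mul_lt_top ENNReal.ofReal_lt_top
    (ENNReal.add_lt_top.2 ⟨ENNReal.one_lt_top, JR_fin hv⟩)).ne
  obtain ⟨N, hN⟩ := exists_nat_gt (B.toReal ^ (1/p))
  obtain ⟨n, hn, hnN⟩ := (hev.and (eventually_ge_atTop N)).exists
  have h1 : JR p (f (φ n)) 1 ≤ B := (JR_le hp (hU _ (hfU (φ n))).good hv.good).trans
    (mul_le_mul' le_rfl (add_le_add hn.le le_rfl))
  have h2 := hf (φ n)
  rw [dpOrigin_eq (hU _ (hfU (φ n))).good] at h2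
  have h3 : (JR p (f (φ n)) 1).toReal ^ (1/p) ≤ B.toReal ^ (1/p) :=
    Real.rpow_le_rpow ENNReal.toReal_nonneg (ENNReal.toReal_mono hBtop h1) (by positivity)
  have h4 : (N:ℝ) ≤ φ n := by exact_mod_cast hnN.trans (hφ.id_le n)
  linarith

theorem forward_elc (hp : 0 < p) {U : Set (Em m → ℝ)} (hU : ∀ u ∈ U, IsFuzzyBp p u)
    (H : ∀ f : ℕ → (Em m → ℝ), (∀ n, f n ∈ U) →
        ∃ (φ : ℕ → ℕ) (v : Em m → ℝ), StrictMono φ ∧ IsFuzzyBp p v ∧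
          Tendsto (fun n => dp p (f (φ n)) v) atTop (𝓝 0)) : PMELC p U := by
  by_contra hcon
  simp only [PMELC, not_forall, not_exists, not_and, not_lt] at hcon
  obtain ⟨ε, hε, hcon⟩ := hcon
  have hc : ∀ n : ℕ, ∃ u ∈ U, ∃ h : ℝ, 0 ≤ h ∧ h < 1 / ((n:ℝ) + 1) ∧
      ε ≤ (JS p u h).toReal ^ (1/p) := by
    intro n
    obtain ⟨h, h0, hlt, u, hu, hle⟩ := hcon (1 / ((n:ℝ) + 1)) (by positivity)
    rw [JS_eq (hU u hu).good h0] at hle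
    exact ⟨u, hu, h, h0, hlt, hle⟩
  choose f hfU h h0 hlt hle using hc
  obtain ⟨φ, v, hφ, hv, hlim⟩ := H f hfU
  have hJ := JJ_tendsto hp (fun n => hU _ (hfU (φ n))) hv hlim
  have hh : Tendsto h atTop (𝓝 0) :=
    squeeze_zero h0 (fun n => (hlt n).le) tendsto_one_div_add_atTop_nhds_zero_nat
  have hS := single_left hp hv (fun n => h0 (φ n)) (hh.comp hφ.tendsto_atTop)
  have hsum := ENNReal.Tendsto.const_mul (a := ENNReal.ofReal (3 ^ p)) ((hJ.add hS).add hJ)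
    (Or.inr ENNReal.ofReal_ne_top)
  simp only [add_zero, mul_zero] at hsum
  have hJS : Tendsto (fun n => JS p (f (φ n)) (h (φ n))) atTop (𝓝 0) :=
    tendsto_of_tendsto_of_tendsto_of_le_of_le tendsto_const_nhds hsum (fun _ => zero_le)
      (fun n => JS_le hp (hU _ (hfU (φ n))).good hv.good (h0 (φ n)))
  have h1 := ((ENNReal.tendsto_toReal ENNReal.zero_ne_top).comp hJS).rpow_const
    (p := 1/p) (Or.inr (by positivity))
  simp only [ENNReal.toReal_zero, Function.comp_def] at h1
  rw [Real.zero_rpow (by positivity)] at h1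
  obtain ⟨n, hn⟩ := (h1.eventually (gt_mem_nhds hε)).exists
  exact absurd (hle (φ n)) (not_le.2 hn)

abbrev QI := {q : ℚ // 0 < (q:ℝ) ∧ (q:ℝ) < 1}

theorem exists_qi {a b : ℝ} (ha : 0 ≤ a) (hab : a < b) (hb : b ≤ 1) :
    ∃ q : QI, a < (q.1 : ℝ) ∧ (q.1 : ℝ) < b := by
  obtain ⟨q, h1, h2⟩ := exists_rat_btwn hab
  exact ⟨⟨q, ha.trans_lt h1, h2.trans_le hb⟩, h1, h2⟩

theorem limit_good {K : QI → Set (Em m)} (hanti : ∀ q r : QI, (q.1:ℝ) ≤ r.1 → K r ⊆ K q)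
    (hc : ∀ q, IsCompact (K q)) (hn : ∀ q, (K q).Nonempty) :
    ∃ v : Em m → ℝ, Good v ∧ (∀ (q : QI) (b : ℝ), (q.1:ℝ) < b → acut v b ⊆ K q) ∧
      ∀ q : QI, K q ⊆ acut v q.1 := by
  let S : Em m → Set ℝ := fun x => insert 0 {t | ∃ q : QI, x ∈ K q ∧ t = q.1}
  have hbdd : ∀ x, BddAbove (S x) := fun x => ⟨1, by
    rintro t (rfl | ⟨q, _, rfl⟩)
    · exact zero_le_one
    · exact q.2.2.le⟩
  let v : Em m → ℝ := fun x => sSup (S x)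
  have hv0 : ∀ x, 0 ≤ v x := fun x => le_csSup (hbdd x) (mem_insert _ _)
  have hv1 : ∀ x, v x ≤ 1 := fun x => csSup_le ⟨0, mem_insert _ _⟩ (by
    rintro t (rfl | ⟨q, _, rfl⟩)
    · exact zero_le_one
    · exact q.2.2.le)
  have hup : ∀ q : QI, K q ⊆ acut v q.1 := fun q x hx =>
    le_csSup (hbdd x) (mem_insert_of_mem _ ⟨q, hx, rfl⟩)
  have hdown : ∀ (q : QI) (b : ℝ), (q.1:ℝ) < b → acut v b ⊆ K q := by
    intro q b hqb x hx
    have hx' : (q.1:ℝ) < sSup (S x) := hqb.trans_le hx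
    obtain ⟨t, ht, hqt⟩ := exists_lt_of_lt_csSup ⟨0, mem_insert _ _⟩ hx'
    rcases ht with rfl | ⟨r, hr, rfl⟩
    · exact absurd q.2.1 (not_lt.2 hqt.le)
    · exact hanti q r hqt.le hr
  have hcut : ∀ a ∈ Ioc (0:ℝ) 1, acut v a = ⋂ q : {q : QI // (q.1:ℝ) < a}, K q.1 := by
    intro a ha
    apply subset_antisymm
    · exact subset_iInter fun q => hdown q.1 a q.2
    · intro x hx
      rw [mem_iInter] at hx
      show a ≤ v x
      by_contra hlt
      obtain ⟨q, h1, h2⟩ := exists_qi (hv0 x) (not_le.1 hlt) ha.2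
      have : (q.1:ℝ) ≤ v x := hup q (hx ⟨q, h2⟩)
      linarith
  have hclosed : ∀ a ∈ Ioc (0:ℝ) 1, IsClosed (acut v a) := by
    intro a ha
    rw [hcut a ha]
    exact isClosed_iInter fun q => (hc q.1).isClosed
  refine ⟨v, ⟨fun x => ⟨hv0 x, hv1 x⟩, ?_, ?_, ?_⟩, hdown, hup⟩
  · have hne : (acut v 1).Nonempty := by
      rw [hcut 1 ⟨one_pos, le_rfl⟩]
      obtain ⟨q0, _, h0⟩ := exists_qi le_rfl (zero_lt_one (α := ℝ)) le_rfl
      have : Nonempty {q : QI // (q.1:ℝ) < 1} := ⟨⟨q0, h0⟩⟩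
      apply IsCompact.nonempty_iInter_of_directed_nonempty_isCompact_isClosed
      · intro q r
        rcases le_total (q.1.1:ℝ) r.1.1 with h | h
        · exact ⟨r, hanti _ _ h, subset_rfl⟩
        · exact ⟨q, subset_rfl, hanti _ _ h⟩
      · exact fun q => hn q.1
      · exact fun q => hc q.1
      · exact fun q => (hc q.1).isClosed
    obtain ⟨x, hx⟩ := hne
    exact ⟨x, le_antisymm (hv1 x) hx⟩
  · rw [upperSemicontinuous_iff_isClosed_preimage]
    intro a
    have heq : v ⁻¹' Ici a = acut v a := rfl
    rw [heq]
    rcases le_or_gt a 0 with h | h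
    · have : acut v a = univ := eq_univ_of_forall fun x => h.trans (hv0 x)
      rw [this]; exact isClosed_univ
    · rcases le_or_gt a 1 with h1 | h1
      · exact hclosed a ⟨h, h1⟩
      · have : acut v a = ∅ := eq_empty_of_forall_notMem fun x hx =>
          absurd (hv1 x) (not_le.2 (h1.trans_le hx))
        rw [this]; exact isClosed_empty
  · intro a ha
    obtain ⟨q, _, h2⟩ := exists_qi le_rfl ha.1 ha.2
    exact (hc q).of_isClosed_subset (hclosed a ha) (hdown q a h2)

theorem nc_tendsto (x : Em m) {G : ℕ → TopologicalSpace.NonemptyCompacts (Em m)}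
    {K : TopologicalSpace.NonemptyCompacts (Em m)} (h : Tendsto G atTop (𝓝 K)) :
    Tendsto (fun n => infDist x (G n : Set (Em m))) atTop (𝓝 (infDist x (K : Set (Em m)))) := by
  have hc : Continuous (fun s : TopologicalSpace.NonemptyCompacts (Em m) =>
      infDist x (s : Set (Em m))) := (Metric.lipschitz_infDist_set x).continuous
  exact (hc.tendsto K).comp h

theorem select {f : ℕ → Em m → ℝ} (hf : ∀ n, Good (f n)) {R : ℝ → ℝ}
    (hR : ∀ a ∈ Ioc (0:ℝ) 1, ∀ n, acut (f n) a ⊆ closedBall 0 (R a)) :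
    ∃ (φ : ℕ → ℕ) (v : Em m → ℝ), StrictMono φ ∧ Good v ∧
      (∀ a ∈ Ioc (0:ℝ) 1, ∃ R', acut v a ⊆ closedBall 0 R' ∧
        ∀ n, acut (f n) a ⊆ closedBall 0 R') ∧
      ∀ᵐ a ∂(volume.restrict (Ioc (0:ℝ) 1)),
        Tendsto (fun n => hausdorffDist (acut (f (φ n)) a) (acut v a)) atTop (𝓝 0) := by
  have hq : ∀ q : QI, (q.1:ℝ) ∈ Ioc (0:ℝ) 1 := fun q => ⟨q.2.1, q.2.2.le⟩
  let F : ℕ → QI → TopologicalSpace.NonemptyCompacts (Em m) := fun n q =>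
    ⟨⟨acut (f n) q.1, (hf n).compactCuts _ (hq q)⟩, (hf n).ne (hq q).2⟩
  have hS : IsCompact (Set.pi univ fun q : QI =>
      {K : TopologicalSpace.NonemptyCompacts (Em m) | (K : Set (Em m)) ⊆ closedBall 0 (R q.1)}) :=
    isCompact_univ_pi fun q =>
      TopologicalSpace.NonemptyCompacts.isCompact_subsets_of_isCompact (isCompact_closedBall _ _)
  obtain ⟨K, hK, φ, hφ, hlim⟩ := hS.tendsto_subseq (x := F) (fun n q _ => hR _ (hq q) n)
  have hlim' : ∀ (x : Em m) (q : QI), Tendsto (fun n => infDist x (acut (f (φ n)) q.1)) atTop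
      (𝓝 (infDist x (K q))) := by
    intro x q
    have h1 : Tendsto (fun n => F (φ n) q) atTop (𝓝 (K q)) := (tendsto_pi_nhds.1 hlim) q
    have h2 := nc_tendsto (G := fun n => F (φ n) q) (K := K q) x h1
    have h3 : ∀ n, (F (φ n) q : Set (Em m)) = acut (f (φ n)) q.1 := fun n => rfl
    simp only [h3] at h2
    exact h2
  have hanti : ∀ q r : QI, (q.1:ℝ) ≤ r.1 → (K r : Set (Em m)) ⊆ K q := by
    intro q r hqr x hx
    rw [(K q).isCompact.isClosed.mem_iff_infDist_zero (K q).nonempty]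
    apply le_antisymm _ infDist_nonneg
    rw [← infDist_zero_of_mem hx]
    exact le_of_tendsto_of_tendsto' (hlim' x q) (hlim' x r) fun n =>
      infDist_le_infDist_of_subset (acut_anti _ hqr) ((hf _).ne (hq r).2)
  obtain ⟨v, hv, hdown, hup⟩ := limit_good hanti (fun q => (K q).isCompact)
    (fun q => (K q).nonempty)
  have hball : ∀ a ∈ Ioc (0:ℝ) 1, ∃ R', acut v a ⊆ closedBall 0 R' ∧
        ∀ n, acut (f n) a ⊆ closedBall 0 R' := by
    intro a ha
    obtain ⟨q, _, h2⟩ := exists_qi le_rfl ha.1 ha.2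
    exact ⟨R q.1, (hdown q a h2).trans (hK q (mem_univ _)),
      fun n => (acut_anti _ h2.le).trans (hR _ (hq q) n)⟩
  refine ⟨φ, v, hφ, hv, hball, ?_⟩
  let D : ℕ → ℝ → ℝ := fun i a => infDist (dsq m i) (acut v (min a 1))
  have hD : ∀ i, Monotone (D i) := fun i a b hab =>
    infDist_le_infDist_of_subset (acut_anti v (min_le_min_right _ hab)) (hv.ne (min_le_right _ _))
  have hae : ∀ᵐ a ∂(volume : Measure ℝ), ∀ i, ContinuousAt (D i) a := by
    rw [ae_all_iff]
    intro i
    filter_upwards [(hD i).countable_not_continuousAt.ae_notMem volume] with a ha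
    by_contra h; exact ha h
  have hne1 : ∀ᵐ a ∂(volume : Measure ℝ), a ≠ 1 := by
    filter_upwards [(countable_singleton (1:ℝ)).ae_notMem volume] with a ha using ha
  filter_upwards [ae_restrict_mem measurableSet_Ioc, ae_restrict_of_ae hae,
    ae_restrict_of_ae hne1] with a ha hcont ha1
  have ha1' : a < 1 := lt_of_le_of_ne ha.2 ha1
  obtain ⟨R', hR1, hR2⟩ := hball a ha
  apply hd_tendsto (Eventually.of_forall fun n => hR2 (φ n)) hR1
  intro i
  have hDa : D i a = infDist (dsq m i) (acut v a) := by simp only [D, min_eq_left ha.2]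
  rw [← hDa, tendsto_order]
  constructor
  · intro c hc
    have hev : ∀ᶠ b in 𝓝[<] a, c < D i b ∧ 0 < b :=
      nhdsWithin_le_nhds (((hcont i).eventually (lt_mem_nhds hc)).and (lt_mem_nhds ha.1))
    obtain ⟨b, ⟨hcb, hb0⟩, hba⟩ := (hev.and self_mem_nhdsWithin).exists
    have hba : b < a := hba
    obtain ⟨q, hbq, hqa⟩ := exists_qi hb0.le hba ha.2
    have h1 : c < infDist (dsq m i) (K q) := by
      refine hcb.trans_le ?_
      simp only [D, min_eq_left (hba.le.trans ha.2)]
      exact infDist_le_infDist_of_subset ((hup q).trans (acut_anti v hbq.le)) (K q).nonempty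
    filter_upwards [(hlim' (dsq m i) q).eventually (lt_mem_nhds h1)] with n hn
    exact hn.trans_le (infDist_le_infDist_of_subset (acut_anti _ hqa.le) ((hf _).ne ha.2))
  · intro c hc
    have hev : ∀ᶠ b in 𝓝[>] a, D i b < c ∧ b < 1 :=
      nhdsWithin_le_nhds (((hcont i).eventually (gt_mem_nhds hc)).and (gt_mem_nhds ha1'))
    obtain ⟨b, ⟨hcb, hb1⟩, hba⟩ := (hev.and self_mem_nhdsWithin).exists
    have hba : a < b := hba
    obtain ⟨q, haq, hqb⟩ := exists_qi ha.1.le hba hb1.le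
    have h1 : infDist (dsq m i) (K q) < c := by
      refine lt_of_le_of_lt ?_ hcb
      simp only [D, min_eq_left hb1.le]
      exact infDist_le_infDist_of_subset (hdown q b hqb) (hv.ne hb1.le)
    filter_upwards [(hlim' (dsq m i) q).eventually (gt_mem_nhds h1)] with n hn
    exact lt_of_le_of_lt (infDist_le_infDist_of_subset (acut_anti _ haq.le)
      ((hf _).ne (hq q).2)) hn

theorem bdd_JR (hp : 0 < p) {U : Set (Em m → ℝ)} (hU : ∀ u ∈ U, IsFuzzyBp p u) (hb : UPMB p U) :
    ∃ M : ℝ, 0 ≤ M ∧ ∀ u ∈ U, JR p u 1 ≤ ENNReal.ofReal M := by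
  obtain ⟨M, hM⟩ := hb
  refine ⟨(max M 0) ^ p, by positivity, fun u hu => ?_⟩
  have h1 := (hM u hu).trans (le_max_left M 0)
  rw [dpOrigin_eq (hU u hu).good] at h1
  have h2 := Real.rpow_le_rpow (by positivity) h1 hp.le
  rw [← Real.rpow_mul ENNReal.toReal_nonneg, one_div, inv_mul_cancel₀ hp.ne', Real.rpow_one] at h2
  rw [← ENNReal.ofReal_toReal (JR_fin (hU u hu)).ne]
  exact ENNReal.ofReal_le_ofReal h2

theorem rad_bound (hp : 0 < p) {u : Em m → ℝ} (hu : Good u) {M : ℝ} (hM : 0 ≤ M)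
    (h : JR p u 1 ≤ ENNReal.ofReal M) {a : ℝ} (ha : a ∈ Ioc (0:ℝ) 1) :
    rad u a ≤ (M / a) ^ (1/p) := by
  have h1 : ENNReal.ofReal (rad u a ^ p) * ENNReal.ofReal a ≤ JR p u 1 := by
    calc _ = ∫⁻ _ in Ioc 0 a, ENNReal.ofReal (rad u a ^ p) := by
          rw [setLIntegral_const]; simp
      _ ≤ JR p u a := by
          apply setLIntegral_mono' measurableSet_Ioc
          intro b hb
          exact ENNReal.ofReal_le_ofReal (Real.rpow_le_rpow (rad_nonneg _ _)
            (hu.rad_anti hb.1 hb.2 ha.2) hp.le)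
      _ ≤ _ := JR_mono u ha.2
  have h2 := h1.trans h
  rw [← ENNReal.ofReal_mul (Real.rpow_nonneg (rad_nonneg _ _) _),
    ENNReal.ofReal_le_ofReal_iff hM, ← le_div_iff₀ ha.1] at h2
  have h3 := Real.rpow_le_rpow (Real.rpow_nonneg (rad_nonneg _ _) _) h2
    (show 0 ≤ 1/p by positivity)
  rwa [← Real.rpow_mul (rad_nonneg _ _), mul_one_div_cancel hp.ne', Real.rpow_one] at h3

theorem unif_tail (hp : 0 < p) {U : Set (Em m → ℝ)} (hU : ∀ u ∈ U, IsFuzzyBp p u)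
    (hb : UPMB p U) (he : PMELC p U) {ε : ℝ≥0∞} (hε : 0 < ε) :
    ∃ η : ℝ, 0 < η ∧ η ≤ 1 ∧ ∀ u ∈ U, JR p u η ≤ ε := by
  obtain ⟨M, hM0, hM⟩ := bdd_JR hp hU hb
  obtain ⟨ε1, hε1, hle⟩ := small_scale (C := ENNReal.ofReal (3 ^ p)) ENNReal.ofReal_ne_top hε
  obtain ⟨δ, hδ, hδU⟩ := he (ε1 ^ (1/p)) (by positivity)
  set h := min (δ/2) (1/2) with hh
  have hh0 : 0 < h := by positivity
  have hhδ : h < δ := (min_le_left _ _).trans_lt (by linarith)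
  have hh1 : h ≤ 1/2 := min_le_right _ _
  set A := (M/h) ^ (1/p) with hA
  have hA0 : 0 ≤ A := by positivity
  obtain ⟨η1, hη1, hle1⟩ := small_scale (C := ENNReal.ofReal (A ^ p)) ENNReal.ofReal_ne_top
    (ENNReal.ofReal_pos.2 hε1)
  set η := min η1 (1/2) with hη
  have hη0 : 0 < η := by positivity
  have hηh : η ≤ 1/2 := min_le_right _ _
  refine ⟨η, hη0, by linarith, fun u hu => ?_⟩
  have hg := (hU u hu).good
  have hJS : JS p u h ≤ ENNReal.ofReal ε1 := by
    have h1 := hδU h hh0.le hhδ u hu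
    rw [JS_eq hg hh0.le] at h1
    have h2 := (Real.rpow_lt_rpow_iff ENNReal.toReal_nonneg hε1.le (by positivity)).1 h1
    rw [← ENNReal.ofReal_toReal (JS_fin hp (hU u hu) hh0.le).ne]
    exact ENNReal.ofReal_le_ofReal h2.le
  have hsh := lint_shift (fun a => ENNReal.ofReal (rad u a ^ p)) h 0 η
  rw [add_zero] at hsh
  have hsub : Ioc h (h + η) ⊆ Ioc h 1 := Ioc_subset_Ioc_right (by linarith)
  calc JR p u η = ∫⁻ a in Ioc h (h + η), ENNReal.ofReal (rad u (a - h) ^ p) := hsh.symm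
    _ ≤ ∫⁻ a in Ioc h (h + η), ENNReal.ofReal (3 ^ p) *
        (ENNReal.ofReal (hausdorffDist (acut u a) (acut u (a - h)) ^ p)
          + ENNReal.ofReal (A ^ p)) := by
        apply setLIntegral_mono' measurableSet_Ioc
        intro a ha
        have h1 : a ∈ Ioc (0:ℝ) 1 := ⟨hh0.trans ha.1, by linarith [ha.2]⟩
        have h2 : a - h ∈ Ioc (0:ℝ) 1 := ⟨by linarith [ha.1], by linarith [ha.2]⟩
        apply rpow2 hp (rad_nonneg _ _) hausdorffDist_nonneg hA0
        have t1 := hd_tri (N := {0}) (hg.ne h2.2) (hg.ne h1.2) (hg.bdd h2) (hg.bdd h1)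
        rw [hausdorffDist_comm (s := acut u (a - h)) (t := acut u a)] at t1
        have t2 : rad u a ≤ A := (hg.rad_anti hh0 ha.1.le h1.2).trans
          (rad_bound hp hg hM0 (hM u hu) ⟨hh0, by linarith⟩)
        exact t1.trans (add_le_add le_rfl t2)
    _ ≤ ENNReal.ofReal (3 ^ p) * (JS p u h + ENNReal.ofReal (A ^ p) * ENNReal.ofReal η) := by
        rw [lintegral_const_mul' _ _ ENNReal.ofReal_ne_top,
          lintegral_add_right _ measurable_const, setLIntegral_const, Real.volume_Ioc,
          add_sub_cancel_left]
        gcongr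
        exact lintegral_mono_set hsub
    _ ≤ ENNReal.ofReal (3 ^ p) * (ENNReal.ofReal ε1 + ENNReal.ofReal ε1) := by
        gcongr
        refine le_trans ?_ hle1
        refine mul_le_mul' le_rfl ((ENNReal.ofReal_le_ofReal (min_le_left _ _)).trans ?_)
        rw [add_assoc]; exact le_self_add
    _ ≤ _ := le_trans (mul_le_mul' le_rfl le_self_add) hle

theorem backward (hp : 0 < p) {U : Set (Em m → ℝ)} (hU : ∀ u ∈ U, IsFuzzyBp p u)
    (hb : UPMB p U) (he : PMELC p U) (f : ℕ → (Em m → ℝ)) (hf : ∀ n, f n ∈ U) :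
    ∃ (φ : ℕ → ℕ) (v : Em m → ℝ), StrictMono φ ∧ IsFuzzyBp p v ∧
          Tendsto (fun n => dp p (f (φ n)) v) atTop (𝓝 0) := by
  obtain ⟨M, hM0, hM⟩ := bdd_JR hp hU hb
  have hg : ∀ n, Good (f n) := fun n => (hU _ (hf n)).good
  obtain ⟨φ, v, hφ, hv, hball, hae⟩ := select hg (R := fun a => (M/a) ^ (1/p))
    (fun a ha n => ((hg n).subset_ball ha).trans
      (closedBall_subset_closedBall (rad_bound hp (hg n) hM0 (hM _ (hf n)) ha)))
  have fatou : ∀ (η : ℝ) (B : ℝ≥0∞), η ≤ 1 → (∀ u ∈ U, JR p u η ≤ B) → JR p v η ≤ B := by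
    intro η B hη hB
    have hle : volume.restrict (Ioc 0 η) ≤ volume.restrict (Ioc (0:ℝ) 1) :=
      Measure.restrict_mono (Ioc_subset_Ioc_right hη) le_rfl
    have hlim : ∀ᵐ a ∂(volume.restrict (Ioc 0 η)),
        ENNReal.ofReal (rad v a ^ p) =
          liminf (fun n => ENNReal.ofReal (rad (f (φ n)) a ^ p)) atTop := by
      filter_upwards [hae.filter_mono (ae_mono hle), ae_restrict_mem measurableSet_Ioc] with a h ha
      have ha' : a ∈ Ioc (0:ℝ) 1 := ⟨ha.1, ha.2.trans hη⟩
      have h1 : Tendsto (fun n => rad (f (φ n)) a) atTop (𝓝 (rad v a)) := by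
        rw [tendsto_iff_dist_tendsto_zero]
        refine squeeze_zero (fun _ => dist_nonneg) (fun n => ?_) h
        have t1 := hd_tri (N := {0}) ((hg (φ n)).ne ha'.2) (hv.ne ha'.2) ((hg (φ n)).bdd ha')
          (hv.bdd ha')
        have t2 := hd_tri (N := {0}) (hv.ne ha'.2) ((hg (φ n)).ne ha'.2)
          (hv.bdd ha') ((hg (φ n)).bdd ha')
        rw [hausdorffDist_comm (s := acut v a) (t := acut (f (φ n)) a)] at t2
        rw [Real.dist_eq, abs_le]
        unfold rad
        constructor <;> linarith
      exact (ENNReal.tendsto_ofReal (h1.rpow_const (Or.inr hp.le))).liminf_eq.symm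
    calc JR p v η = _ := lintegral_congr_ae hlim
      _ ≤ liminf (fun n => JR p (f (φ n)) η) atTop := lintegral_liminf_le' fun n =>
          (((meas_rad (hg (φ n))).mono_measure hle).pow_const p).ennreal_ofReal
      _ ≤ B := liminf_le_of_frequently_le' (Frequently.of_forall fun n => hB _ (hf (φ n)))
  have hvB : IsFuzzyBp p v := by
    refine ⟨hv.mem01, hv.normal, hv.usc, hv.compactCuts, ?_⟩
    refine ⟨((meas_rad hv).pow_const p).aestronglyMeasurable, ?_⟩
    change HasFiniteIntegral (fun a => rad v a ^ p) _
    rw [hasFiniteIntegral_iff_ofReal (ae_of_all _ fun a => Real.rpow_nonneg (rad_nonneg v a) p)]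
    exact (fatou 1 _ le_rfl hM).trans_lt ENNReal.ofReal_lt_top
  refine ⟨φ, v, hφ, hvB, ?_⟩
  have hJ : Tendsto (fun n => JJ p (f (φ n)) v) atTop (𝓝 0) := by
    apply core
    · intro n; exact ((meas_uv (hg (φ n)) hv).pow_const p).ennreal_ofReal
    · filter_upwards [hae] with a ha
      have := ENNReal.tendsto_ofReal (ha.rpow_const (Or.inr hp.le) (p := p))
      simpa only [Real.zero_rpow hp.ne', ENNReal.ofReal_zero] using this
    · intro η hη
      rcases le_or_gt η 1 with hη1 | hη1
      · obtain ⟨R, hR1, hR2⟩ := hball η ⟨hη, hη1⟩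
        refine ⟨ENNReal.ofReal ((R + R) ^ p), ENNReal.ofReal_ne_top,
          Eventually.of_forall fun n a ha => ENNReal.ofReal_le_ofReal ?_⟩
        apply Real.rpow_le_rpow hausdorffDist_nonneg _ hp.le
        refine ((hg (φ n)).hd_le ⟨hη.trans ha.1, ha.2⟩).trans (add_le_add ?_ ?_)
        · exact rad_le ((hg (φ n)).ne ha.2) ((acut_anti _ ha.1.le).trans (hR2 _))
        · exact rad_le (hv.ne ha.2) ((acut_anti _ ha.1.le).trans hR1)
      · refine ⟨0, ENNReal.zero_ne_top, Eventually.of_forall fun n a ha => ?_⟩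
        exact absurd (ha.1.trans_le ha.2) (not_lt.2 hη1.le)
    · intro ε hε
      obtain ⟨δ, hδ, hδε⟩ := small_scale (C := ENNReal.ofReal (3 ^ p)) ENNReal.ofReal_ne_top hε
      obtain ⟨η, hη0, hη1, hη⟩ := unif_tail hp hU hb he (ENNReal.ofReal_pos.2 hδ)
      refine ⟨η, hη0, hη1, Eventually.of_forall fun n => ?_⟩
      refine ((hg (φ n)).tail_le hp hη1).trans (le_trans (mul_le_mul' le_rfl ?_) hδε)
      exact (add_le_add (hη _ (hf (φ n))) (fatou η _ hη1 hη)).trans le_self_add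
  have h1 := ((ENNReal.tendsto_toReal ENNReal.zero_ne_top).comp hJ).rpow_const
    (p := 1/p) (Or.inr (by positivity))
  simp only [ENNReal.toReal_zero, Function.comp_def] at h1
  rw [Real.zero_rpow (by positivity)] at h1
  exact h1.congr fun n => (dp_eq (hg (φ n)) hv).symm

end Aux

/-- Characterization of relatively compact subsets of
`(F_B(ℝ^m)^p, d_p)`: relative compactness (every sequence has a subsequence
converging in `d_p` to an element of the space) iff uniformly p-mean bounded
and p-mean equi-left-continuous. -/
theorem relatively_compact_iff {m : ℕ} (p : ℝ) (hp : 1 ≤ p)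
    (U : Set (Em m → ℝ)) (hU : ∀ u ∈ U, IsFuzzyBp p u) :
    (∀ f : ℕ → (Em m → ℝ), (∀ n, f n ∈ U) →
        ∃ (φ : ℕ → ℕ) (v : Em m → ℝ), StrictMono φ ∧ IsFuzzyBp p v ∧
          Tendsto (fun n => dp p (f (φ n)) v) atTop (nhds 0))
      ↔ (UPMB p U ∧ PMELC p U) := by
  have hp0 : 0 < p := lt_of_lt_of_le one_pos hp
  exact ⟨fun H => ⟨forward_bdd hp0 hU H, forward_elc hp0 hU H⟩,
    fun h f hf => backward hp0 hU h.1 h.2 f hf⟩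

end
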